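/- arXiv:2006.00198 — 2 statements merged into one kernel-verified Lean document; each statement's English description precedes it below -/
import Mathlib

section
/- Let G be a finite abelian group of odd order, n ≥ 1, and let s : Fin n → G be an injective map such that the partial splitting condition G ≥ {1,2} ◇₂ S holds for S = {s₁,…,sₙ}: the sums ∑ᵢ eᵢ·sᵢ over all e ∈ {0,1,2}ⁿ with 1 ≤ wt(e) ≤ 2 are pairwise distinct and nonzero. Then, as integers, |G| + 2·m₃(G) ≥ 4n² − 19n − 10, where m₃(G) is the number of elements x ∈ G with x ≠ 0 and 3x = 0. -/
open Finset

/-- Hamming weight of an integer vector: the number of nonzero entries. -/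
def wt {n : ℕ} (x : Fin n → ℤ) : ℕ := (Finset.univ.filter (fun i => x i ≠ 0)).card

/-- The `(n,t,k₊,k₋)`-error-ball in `ℤⁿ`. -/
def errBall (n t : ℕ) (kp km : ℤ) : Set (Fin n → ℤ) :=
  {x | (∀ i, -km ≤ x i ∧ x i ≤ kp) ∧ wt x ≤ t}

/-- `Tiles B T` : every `z ∈ ℤⁿ` is uniquely `z = v + b` with `v ∈ T` and `b ∈ B`. -/
def Tiles {n : ℕ} (B T : Set (Fin n → ℤ)) : Prop :=
  ∀ z : Fin n → ℤ, ∃! p : (Fin n → ℤ) × (Fin n → ℤ),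
    p.1 ∈ T ∧ p.2 ∈ B ∧ z = p.1 + p.2

/-- The partial splitting condition `G ≥ M ◇ₜ S` : the sums `∑ i, e i • s i`, over all
`e` with entries in `M ∪ {0}` and `1 ≤ wt e ≤ t`, are pairwise distinct and nonzero. -/
def PartialSplits {G : Type*} [AddCommGroup G] (M : Set ℤ) (t : ℕ) {n : ℕ}
    (s : Fin n → G) : Prop :=
  (∀ e : Fin n → ℤ, (∀ i, e i ∈ M ∨ e i = 0) → 1 ≤ wt e → wt e ≤ t →
      ∑ i, e i • s i ≠ 0) ∧
  ∀ e f : Fin n → ℤ, (∀ i, e i ∈ M ∨ e i = 0) → (∀ i, f i ∈ M ∨ f i = 0) →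
    1 ≤ wt e → wt e ≤ t → 1 ≤ wt f → wt f ≤ t →
    ∑ i, e i • s i = ∑ i, f i • s i → e = f


def Bv {n : ℕ} (i j : Fin n) (a b : ℤ) : Fin n → ℤ :=
  fun m => (if m = i then a else 0) + (if m = j then b else 0)

def BallV {n : ℕ} (e : Fin n → ℤ) : Prop :=
  (∀ i, e i ∈ ({1, 2} : Set ℤ) ∨ e i = 0) ∧ 1 ≤ wt e ∧ wt e ≤ 2

lemma ballV_Bv {n : ℕ} (i j : Fin n) (a b : ℤ) (ha : a = 1 ∨ a = 2)
    (hb : b = 0 ∨ b = 1 ∨ b = 2) (hij : i = j → a + b ≤ 2) : BallV (Bv i j a b) := by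
  refine ⟨?_, ?_, ?_⟩
  · intro m
    simp only [Bv, Set.mem_insert_iff, Set.mem_singleton_iff]
    split_ifs <;> grind
  · unfold wt
    apply Finset.card_pos.mpr
    refine ⟨i, ?_⟩
    rw [Finset.mem_filter]
    refine ⟨Finset.mem_univ _, ?_⟩
    simp only [Bv]
    split_ifs <;> grind
  · unfold wt
    refine le_trans (Finset.card_le_card (t := {i, j}) ?_) Finset.card_le_two
    intro m hm
    have hm := (Finset.mem_filter.mp hm).2
    simp only [Bv, Finset.mem_insert, Finset.mem_singleton] at hm ⊢
    grind

lemma sum_Bv {n : ℕ} {G : Type} [AddCommGroup G] (s : Fin n → G) (i j : Fin n) (a b : ℤ) :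
    ∑ m, Bv i j a b m • s m = a • s i + b • s j := by
  simp [Bv, add_smul, Finset.sum_add_distrib, ite_smul]

lemma bv_unique {n : ℕ} {G : Type} [AddCommGroup G] {s : Fin n → G}
    (h : PartialSplits {1, 2} 2 s) (i j k l : Fin n) (a b c d : ℤ)
    (ha : a = 1 ∨ a = 2) (hb : b = 0 ∨ b = 1 ∨ b = 2) (hij : i = j → a + b ≤ 2)
    (hc : c = 1 ∨ c = 2) (hd : d = 0 ∨ d = 1 ∨ d = 2) (hkl : k = l → c + d ≤ 2)
    (he : a • s i + b • s j = c • s k + d • s l) (m : Fin n) :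
    (if m = i then a else 0) + (if m = j then b else 0) =
    (if m = k then c else 0) + (if m = l then d else 0) := by
  have h1 := ballV_Bv i j a b ha hb hij
  have h2 := ballV_Bv k l c d hc hd hkl
  have := h.2 _ _ h1.1 h2.1 h1.2.1 h1.2.2 h2.2.1 h2.2.2 (by rw [sum_Bv, sum_Bv, he])
  exact congrFun this m

open Classical in
noncomputable def PS {n : ℕ} {G : Type} [AddCommGroup G] (s : Fin n → G) (g : G) :
    Finset (Fin n) :=
  univ.filter (fun i => ∃ e, BallV e ∧ ∑ m, e m • s m = g ∧ e i ≠ 0)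

lemma card_PS {n : ℕ} {G : Type} [AddCommGroup G] {s : Fin n → G}
    (h : PartialSplits {1, 2} 2 s) (g : G) : (PS s g).card ≤ 2 := by
  by_cases hE : ∃ e, BallV e ∧ ∑ m, e m • s m = g
  · obtain ⟨e, he, hg⟩ := hE
    refine le_trans (Finset.card_le_card ?_) he.2.2
    intro i hi
    simp only [PS, Finset.mem_filter, Finset.mem_univ, true_and] at hi ⊢
    obtain ⟨f, hf, hfg, hi⟩ := hi
    have := h.2 _ _ he.1 hf.1 he.2.1 he.2.2 hf.2.1 hf.2.2 (by rw [hg, hfg])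
    rwa [this]
  · have : PS s g = ∅ := by
      ext i
      simp only [PS, Finset.mem_filter, Finset.mem_univ, true_and, Finset.notMem_empty, iff_false]
      rintro ⟨e, he, hg, _⟩
      exact hE ⟨e, he, hg⟩
    simp [this]

lemma mem_PS {n : ℕ} {G : Type} [AddCommGroup G] (s : Fin n → G) (g : G)
    (i j : Fin n) (a b : ℤ) (ha : a = 1 ∨ a = 2)
    (hb : b = 0 ∨ b = 1 ∨ b = 2) (hij : i = j → a + b ≤ 2)
    (hg : a • s i + b • s j = g) : i ∈ PS s g := by
  simp only [PS, Finset.mem_filter, Finset.mem_univ, true_and]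
  refine ⟨_, ballV_Bv i j a b ha hb hij, by rw [sum_Bv, hg], ?_⟩
  simp only [Bv]
  split_ifs <;> grind

open Classical in
noncomputable def QS {n : ℕ} {G : Type} [AddCommGroup G] (s : Fin n → G) (g : G) :
    Finset (Fin n) :=
  univ.filter (fun i => ∃ j, i ≠ j ∧ s i + (2 : ℤ) • s j = g)

lemma card_QS {n : ℕ} {G : Type} [AddCommGroup G] {s : Fin n → G}
    (h : PartialSplits {1, 2} 2 s) (g : G) : (QS s g).card ≤ 1 := by
  rw [Finset.card_le_one]
  intro a ha b hb
  simp only [QS, Finset.mem_filter, Finset.mem_univ, true_and] at ha hb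
  obtain ⟨j, h1, h2⟩ := ha
  obtain ⟨k, h3, h4⟩ := hb
  have := bv_unique h a j b k 1 2 1 2 (by simp) (by simp) (by simp [h1]) (by simp) (by simp)
    (by simp [h3]) (by simpa using h2.trans h4.symm) a
  grind

lemma two_inj {G : Type} [AddCommGroup G] [Fintype G] (hodd : Odd (Fintype.card G))
    {x y : G} (h : (2 : ℤ) • x = (2 : ℤ) • y) : x = y := by
  obtain ⟨k, hk⟩ := hodd
  have e : ∀ z : G, z = (k + 1 : ℤ) • ((2 : ℤ) • z) := by
    intro z
    have : (Fintype.card G) • z = 0 := card_nsmul_eq_zero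
    rw [hk] at this
    have h2 : ((2 * k + 1 : ℕ) : ℤ) • z = 0 := by rw [natCast_zsmul]; exact this
    rw [smul_smul]
    have : ((k : ℤ) + 1) * 2 = ((2 * k + 1 : ℕ) : ℤ) + 1 := by push_cast; ring
    rw [this, add_smul, h2]; simp
  rw [e x, e y, h]

lemma two_surj {G : Type} [AddCommGroup G] [Fintype G] (hodd : Odd (Fintype.card G))
    (x : G) : ∃ y : G, (2 : ℤ) • y = x :=
  (Finite.injective_iff_surjective.mp (fun _ _ h => two_inj hodd h)) x

noncomputable def hf {G : Type} [AddCommGroup G] [Fintype G] (hodd : Odd (Fintype.card G))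
    (x : G) : G := (two_surj hodd x).choose

lemma hf_eq {G : Type} [AddCommGroup G] [Fintype G] (hodd : Odd (Fintype.card G))
    (x y : G) (h : (2 : ℤ) • y = x) : y = hf hodd x :=
  two_inj hodd (h.trans (two_surj hodd x).choose_spec.symm)

lemma card_fst {n : ℕ} (F : Fin n → Finset (Fin n)) (c : ℕ) (hF : ∀ i, (F i).card ≤ c) :
    (univ.filter (fun p : Fin n × Fin n => p.2 ∈ F p.1)).card ≤ c * n := by
  have : (univ.filter (fun p : Fin n × Fin n => p.2 ∈ F p.1)).card = ∑ i, (F i).card := by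
    rw [← Finset.card_sigma]
    refine Finset.card_bij (fun p _ => ⟨p.1, p.2⟩) ?_ ?_ ?_
    · intro p hp; simpa using hp
    · rintro ⟨a, b⟩ _ ⟨c, d⟩ _ h; simpa using h
    · rintro ⟨a, b⟩ h; exact ⟨(a, b), by simpa using h, rfl⟩
  rw [this]
  refine (Finset.sum_le_sum (fun i _ => hF i)).trans ?_
  simp [mul_comm]

lemma card_snd {n : ℕ} (F : Fin n → Finset (Fin n)) (c : ℕ) (hF : ∀ i, (F i).card ≤ c) :
    (univ.filter (fun p : Fin n × Fin n => p.1 ∈ F p.2)).card ≤ c * n := by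
  refine le_trans (le_of_eq ?_) (card_fst F c hF)
  refine Finset.card_bij (fun p _ => (p.2, p.1)) ?_ ?_ ?_
  · intro p hp; simpa using hp
  · rintro ⟨a, b⟩ _ ⟨c, d⟩ _ h; simp at h; grind
  · rintro ⟨a, b⟩ h; exact ⟨(b, a), by simpa using h, rfl⟩

section coll
variable {n : ℕ} {G : Type} [AddCommGroup G] [Fintype G] {s : Fin n → G}

/-- bad pairs for the differences -/
def BadD (s : Fin n → G) (i j : Fin n) : Prop :=
  j ∈ QS s ((3 : ℤ) • s i) ∨ i ∈ QS s ((3 : ℤ) • s j)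

def BadE (hodd : Odd (Fintype.card G)) (s : Fin n → G) (i j : Fin n) : Prop :=
  j ∈ PS s ((3 : ℤ) • s i) ∨ j ∈ PS s ((4 : ℤ) • s i) ∨ i ∈ PS s (hf hodd ((3 : ℤ) • s j))

lemma coll_DD (h : PartialSplits {1, 2} 2 s) {i j k l : Fin n} (hij : i ≠ j) (hkl : k ≠ l)
    (he : s i - s j = s k - s l) : i = k ∧ j = l := by
  have := bv_unique h i l k j 1 1 1 1 (by simp) (by simp) (by simp) (by simp) (by simp)
    (by simp) (by simp only [one_smul]; grind)
  have h1 := this i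
  have h2 := this j
  grind

lemma coll_DDD (h : PartialSplits {1, 2} 2 s) {i j k l : Fin n} (hij : i ≠ j) (hkl : k ≠ l)
    (hB : ¬ BadD s i j) (hT : (3 : ℤ) • s i ≠ (3 : ℤ) • s j)
    (he : s i - s j = (2 : ℤ) • (s k - s l)) : False := by
  -- s i + 2 s l = 2 s k + s j
  have he' : s i + (2 : ℤ) • s l = s j + (2 : ℤ) • s k := by
    rw [smul_sub] at he
    have := congrArg (fun z => z + s j + (2 : ℤ) • s l) he
    convert this using 1 <;> abel
  by_cases h1 : i = l
  · subst h1
    have e3 : s j + (2 : ℤ) • s k = (3 : ℤ) • s i := by rw [← he']; module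
    by_cases h2 : j = k
    · subst h2; apply hT; rw [← e3]; module
    · apply hB; left
      simp only [QS, Finset.mem_filter, Finset.mem_univ, true_and]
      exact ⟨k, h2, e3⟩
  · by_cases h2 : j = k
    · subst h2
      apply hB; right
      simp only [QS, Finset.mem_filter, Finset.mem_univ, true_and]
      exact ⟨l, h1, by rw [he']; module⟩
    · have := bv_unique h i l j k 1 2 1 2 (by simp) (by simp) (by simp [h1]) (by simp) (by simp)
        (by simp [h2]) (by simpa using he') i
      grind

/-- E vs E -/
lemma coll_EE (hodd : Odd (Fintype.card G)) (h : PartialSplits {1, 2} 2 s)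
    (hs : Function.Injective s) {i j k l : Fin n}
    (hij : i ≠ j) (hkl : k ≠ l) (hB : ¬ BadE hodd s i j) (hB' : ¬ BadE hodd s k l)
    (he : (2 : ℤ) • s i - s j = (2 : ℤ) • s k - s l) :
    (i = k ∧ j = l) ∨ (k = j ∧ l = i ∧ (3 : ℤ) • s i = (3 : ℤ) • s j) := by
  have he' : s l + (2 : ℤ) • s i = s j + (2 : ℤ) • s k := by
    have := congrArg (fun z => z + s j + s l) he
    convert this using 1 <;> abel
  by_cases h1 : l = i
  · subst h1
    have e3 : s j + (2 : ℤ) • s k = (3 : ℤ) • s l := by rw [← he']; module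
    by_cases h2 : j = k
    · subst h2; right; refine ⟨rfl, rfl, ?_⟩; rw [← e3]; module
    · exfalso; apply hB; left
      exact mem_PS s _ j k 1 2 (by simp) (by simp) (by simp [h2]) (by simpa using e3)
  · by_cases h2 : j = k
    · subst h2
      exfalso; apply hB'; left
      exact mem_PS s _ l i 1 2 (by simp) (by simp) (by simp [h1])
        (by rw [one_smul, he']; module)
    · have := bv_unique h l i j k 1 2 1 2 (by simp) (by simp) (by simp [h1]) (by simp) (by simp)
        (by simp [h2]) (by simpa using he')
      have a := this i
      have b := this j
      grind

/-- D vs E -/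
lemma coll_DE (hodd : Odd (Fintype.card G)) (h : PartialSplits {1, 2} 2 s) {i j k l : Fin n}
    (hij : i ≠ j) (hkl : k ≠ l) (hB : ¬ BadE hodd s i j)
    (he : (2 : ℤ) • s i - s j = s k - s l) : False := by
  have he' : s l + (2 : ℤ) • s i = s j + s k := by
    have := congrArg (fun z => z + s j + s l) he
    convert this using 1 <;> abel
  by_cases h1 : l = i
  · subst h1
    apply hB; left
    exact mem_PS s _ j k 1 1 (by simp) (by simp) (by simp)
      (by rw [one_smul, one_smul, ← he']; module)
  · have := bv_unique h l i j k 1 2 1 1 (by simp) (by simp) (by simp [h1]) (by simp) (by simp)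
        (by simp) (by simpa using he')
    have a := this i
    have b := this j
    grind

/-- 2D vs E -/
lemma coll_DDE (hodd : Odd (Fintype.card G)) (h : PartialSplits {1, 2} 2 s) {i j k l : Fin n}
    (hij : i ≠ j) (hkl : k ≠ l) (hB : ¬ BadE hodd s i j)
    (he : (2 : ℤ) • s i - s j = (2 : ℤ) • (s k - s l)) : False := by
  have he' : (2 : ℤ) • s i + (2 : ℤ) • s l = s j + (2 : ℤ) • s k := by
    rw [smul_sub] at he
    have := congrArg (fun z => z + s j + (2 : ℤ) • s l) he
    convert this using 1 <;> abel
  by_cases h2 : j = k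
  · subst h2
    apply hB; right; right
    refine mem_PS s _ i l 1 1 (by simp) (by simp) (by simp) ?_
    apply hf_eq
    rw [smul_add, one_smul, one_smul, he']; module
  · by_cases h1 : i = l
    · subst h1
      apply hB; right; left
      exact mem_PS s _ j k 1 2 (by simp) (by simp) (by simp [h2])
        (by rw [one_smul, ← he']; module)
    · have := bv_unique h i l j k 2 2 1 2 (by simp) (by simp) (by simp [h1]) (by simp) (by simp)
        (by simp [h2]) (by simpa using he') j
      grind

/-- E vs -E -/
lemma coll_EN (hodd : Odd (Fintype.card G)) (h : PartialSplits {1, 2} 2 s) {i j k l : Fin n}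
    (hij : i ≠ j) (hkl : k ≠ l) (hB : ¬ BadE hodd s i j)
    (he : (2 : ℤ) • s i - s j = s l - (2 : ℤ) • s k) : False := by
  have he' : (2 : ℤ) • s i + (2 : ℤ) • s k = s j + s l := by
    have := congrArg (fun z => z + s j + (2 : ℤ) • s k) he
    convert this using 1 <;> abel
  by_cases h1 : i = k
  · subst h1
    apply hB; right; left
    exact mem_PS s _ j l 1 1 (by simp) (by simp) (by simp)
      (by rw [one_smul, one_smul, ← he']; module)
  · have := bv_unique h i k j l 2 2 1 1 (by simp) (by simp) (by simp [h1]) (by simp) (by simp)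
        (by simp) (by simpa using he')
    have a := this i
    have b := this k
    have c := this j
    grind

end coll

lemma card_diff_ge {α : Type} [DecidableEq α] (O A B : Finset α) :
    (O.card : ℤ) - A.card - B.card ≤ ((O \ (A ∪ B)).card : ℤ) := by
  have h1 := Finset.le_card_sdiff (A ∪ B) O
  have h2 := Finset.card_union_le A B
  omega

theorem stmt_17 (n : ℕ) (hn : 1 ≤ n)
    (G : Type) [AddCommGroup G] [Fintype G] (hodd : Odd (Fintype.card G))
    (s : Fin n → G) (hs : Function.Injective s)
    (hsplit : PartialSplits {1, 2} 2 s) :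
    4 * (n : ℤ) ^ 2 - 19 * (n : ℤ) - 10 ≤
      (Fintype.card G : ℤ) + 2 * (({x : G | x ≠ 0 ∧ 3 • x = 0}.ncard : ℤ)) := by
  classical
  set m := {x : G | x ≠ 0 ∧ 3 • x = 0}.ncard with hm
  let O : Finset (Fin n × Fin n) := univ.filter (fun p => p.1 ≠ p.2)
  let T : Finset (Fin n × Fin n) :=
    univ.filter (fun p => p.1 ≠ p.2 ∧ (3 : ℤ) • s p.1 = (3 : ℤ) • s p.2)
  let T1 := T.filter (fun p => p.1 < p.2)
  let T2 := T.filter (fun p => ¬ p.1 < p.2)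
  let RD : Finset (Fin n × Fin n) := univ.filter (fun p => BadD s p.1 p.2)
  let RE : Finset (Fin n × Fin n) := univ.filter (fun p => BadE hodd s p.1 p.2)
  let fD : Fin n × Fin n → G := fun p => s p.1 - s p.2
  let fDD : Fin n × Fin n → G := fun p => (2 : ℤ) • (s p.1 - s p.2)
  let fE : Fin n × Fin n → G := fun p => (2 : ℤ) • s p.1 - s p.2
  let fN : Fin n × Fin n → G := fun p => s p.2 - (2 : ℤ) • s p.1
  let D := O \ (RD ∪ T)
  let E := O \ (RE ∪ T1)
  let N := O \ (RE ∪ T2)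
  have mD : ∀ p ∈ D, p.1 ≠ p.2 ∧ ¬ BadD s p.1 p.2 ∧ (3 : ℤ) • s p.1 ≠ (3 : ℤ) • s p.2 := by
    intro p hp; simp [D, O, RD, T] at hp; tauto
  have mE : ∀ p ∈ E, p.1 ≠ p.2 ∧ ¬ BadE hodd s p.1 p.2 ∧
      ((3 : ℤ) • s p.1 = (3 : ℤ) • s p.2 → ¬ p.1 < p.2) := by
    intro p hp; simp [E, O, RE, T, T1] at hp; simp only [not_lt]; tauto
  have mN : ∀ p ∈ N, p.1 ≠ p.2 ∧ ¬ BadE hodd s p.1 p.2 ∧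
      ((3 : ℤ) • s p.1 = (3 : ℤ) • s p.2 → p.1 < p.2) := by
    intro p hp; simp [N, O, RE, T, T2] at hp; tauto
  have mO : ∀ p ∈ O, p.1 ≠ p.2 := by intro p hp; simpa [O] using hp
  have iD0 : Set.InjOn fD O := by
    intro p hp q hq he
    exact Prod.ext_iff.mpr (coll_DD hsplit (mO p hp) (mO q hq) he)
  have iD : Set.InjOn fD D := iD0.mono (by intro x hx; exact (Finset.mem_sdiff.mp hx).1)
  have iDD : Set.InjOn fDD O := by
    intro p hp q hq he
    exact iD0 hp hq (two_inj hodd he)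
  have iE : Set.InjOn fE E := by
    intro p hp q hq he
    obtain ⟨p1, p2, p3⟩ := mE p hp
    obtain ⟨q1, q2, q3⟩ := mE q hq
    rcases coll_EE hodd hsplit hs p1 q1 p2 q2 he with h | ⟨h1, h2, h3⟩
    · exact Prod.ext_iff.mpr h
    · exfalso
      rw [h1, h2] at q3
      have := p3 h3
      have := q3 h3.symm
      omega
  have iN : Set.InjOn fN N := by
    intro p hp q hq he
    obtain ⟨p1, p2, p3⟩ := mN p hp
    obtain ⟨q1, q2, q3⟩ := mN q hq
    have he' : (2 : ℤ) • s p.1 - s p.2 = (2 : ℤ) • s q.1 - s q.2 := by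
      have := congrArg (fun z => - z) he
      simpa [fN] using this
    rcases coll_EE hodd hsplit hs p1 q1 p2 q2 he' with h | ⟨h1, h2, h3⟩
    · exact Prod.ext_iff.mpr h
    · exfalso
      rw [h1, h2] at q3
      have := p3 h3
      have := q3 h3.symm
      omega
  have d1 : Disjoint (D.image fD) (O.image fDD) := by
    rw [Finset.disjoint_left]; intro x hx hy
    obtain ⟨p, hp, rfl⟩ := Finset.mem_image.mp hx
    obtain ⟨q, hq, he⟩ := Finset.mem_image.mp hy
    obtain ⟨p1, p2, p3⟩ := mD p hp
    exact coll_DDD hsplit p1 (mO q hq) p2 p3 he.symm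
  have d2 : Disjoint (D.image fD ∪ O.image fDD) (E.image fE) := by
    rw [Finset.disjoint_left]; intro x hx hy
    obtain ⟨q, hq, rfl⟩ := Finset.mem_image.mp hy
    obtain ⟨q1, q2, q3⟩ := mE q hq
    rcases Finset.mem_union.mp hx with hx | hx
    · obtain ⟨p, hp, he⟩ := Finset.mem_image.mp hx
      exact coll_DE hodd hsplit q1 (mD p hp).1 q2 he.symm
    · obtain ⟨p, hp, he⟩ := Finset.mem_image.mp hx
      exact coll_DDE hodd hsplit q1 (mO p hp) q2 he.symm
  have d3 : Disjoint (D.image fD ∪ O.image fDD ∪ E.image fE) (N.image fN) := by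
    rw [Finset.disjoint_left]; intro x hx hy
    obtain ⟨q, hq, rfl⟩ := Finset.mem_image.mp hy
    obtain ⟨q1, q2, q3⟩ := mN q hq
    rcases Finset.mem_union.mp hx with hx | hx
    · rcases Finset.mem_union.mp hx with hx | hx
      · obtain ⟨p, hp, he⟩ := Finset.mem_image.mp hx
        refine coll_DE (k := p.2) (l := p.1) hodd hsplit q1 (mD p hp).1.symm q2 ?_
        have := congrArg (fun z => - z) he
        simp [fN, fD] at this
        simpa using this.symm
      · obtain ⟨p, hp, he⟩ := Finset.mem_image.mp hx
        refine coll_DDE (k := p.2) (l := p.1) hodd hsplit q1 (mO p hp).symm q2 ?_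
        have := congrArg (fun z => - z) he
        simp only [fN, fDD, ← smul_neg, neg_sub] at this
        exact this.symm
    · obtain ⟨p, hp, he⟩ := Finset.mem_image.mp hx
      exact coll_EN hodd hsplit (mE p hp).1 q1 (mE p hp).2.1 he
  have htot : D.card + O.card + E.card + N.card ≤ Fintype.card G := by
    rw [← Finset.card_image_of_injOn iD, ← Finset.card_image_of_injOn iDD,
      ← Finset.card_image_of_injOn iE, ← Finset.card_image_of_injOn iN,
      ← Finset.card_union_of_disjoint d1, ← Finset.card_union_of_disjoint d2,
      ← Finset.card_union_of_disjoint d3]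
    exact Finset.card_le_univ _
  have cO : (O.card : ℤ) = n * n - n := by
    have : O = (univ : Finset (Fin n)).offDiag := by ext p; simp [O]
    rw [this, Finset.offDiag_card]
    simp only [Finset.card_univ, Fintype.card_fin]
    rw [Nat.cast_sub (by nlinarith)]; push_cast; ring
  have cT : T.card ≤ m := by
    rw [hm, Set.ncard_eq_toFinset_card']
    refine Finset.card_le_card_of_injOn fD ?_ ?_
    · intro p hp
      simp [T] at hp
      simp only [Set.coe_toFinset, Set.mem_setOf_eq, fD]
      refine ⟨fun h => hp.1 (hs (sub_eq_zero.mp h)), ?_⟩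
      rw [← natCast_zsmul, smul_sub, sub_eq_zero]
      exact_mod_cast hp.2
    · refine iD0.mono ?_
      intro p hp
      simp [T] at hp
      simp [O, hp.1]
  have cT12 : T1.card + T2.card = T.card := Finset.card_filter_add_card_filter_not _
  have cRD : RD.card ≤ 2 * n := by
    have a := card_fst (fun i => QS s ((3 : ℤ) • s i)) 1 (fun i => card_QS hsplit _)
    have b := card_snd (fun i => QS s ((3 : ℤ) • s i)) 1 (fun i => card_QS hsplit _)
    have c : RD ⊆ (univ.filter (fun p : Fin n × Fin n => p.2 ∈ QS s ((3 : ℤ) • s p.1))) ∪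
      (univ.filter (fun p : Fin n × Fin n => p.1 ∈ QS s ((3 : ℤ) • s p.2))) := by
      intro p hp; have hp := (Finset.mem_filter.mp hp).2; simpa [BadD] using hp
    have := (Finset.card_le_card c).trans (Finset.card_union_le _ _)
    omega
  have cRE : RE.card ≤ 6 * n := by
    have a := card_fst (fun i => PS s ((3 : ℤ) • s i)) 2 (fun i => card_PS hsplit _)
    have b := card_fst (fun i => PS s ((4 : ℤ) • s i)) 2 (fun i => card_PS hsplit _)
    have b2 := card_snd (fun i => PS s (hf hodd ((3 : ℤ) • s i))) 2 (fun i => card_PS hsplit _)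
    have c : RE ⊆ (univ.filter (fun p : Fin n × Fin n => p.2 ∈ PS s ((3 : ℤ) • s p.1))) ∪
      ((univ.filter (fun p : Fin n × Fin n => p.2 ∈ PS s ((4 : ℤ) • s p.1))) ∪
      (univ.filter (fun p : Fin n × Fin n => p.1 ∈ PS s (hf hodd ((3 : ℤ) • s p.2))))) := by
      intro p hp; have hp := (Finset.mem_filter.mp hp).2; simpa [BadE] using hp
    have := (Finset.card_le_card c).trans (Finset.card_union_le _ _)
    have := Finset.card_union_le (univ.filter (fun p : Fin n × Fin n => p.2 ∈ PS s ((4 : ℤ) • s p.1)))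
      (univ.filter (fun p : Fin n × Fin n => p.1 ∈ PS s (hf hodd ((3 : ℤ) • s p.2))))
    omega
  have x1 := card_diff_ge O RD T
  have x2 := card_diff_ge O RE T1
  have x3 := card_diff_ge O RE T2
  zify at htot cT cT12 cRD cRE
  simp only [D, E, N] at htot
  nlinarith
end

section
/- Let n ≥ 3 be an integer. If there exists a lattice Λ ⊆ ℤⁿ (additive subgroup of ℤⁿ) such that the error-ball B(n,2,2,0) tiles ℤⁿ by Λ, then n = 3 or n = 11. Moreover, in any such tiling the associated quotient group ℤⁿ/Λ is isomorphic, as an abelian group, to ℤ/19ℤ when n = 3 and to (ℤ/3ℤ)⁵ when n = 11. -/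
open Finset

lemma dio_aux (n x y : ℕ) (hn : 3 ≤ n) (h1 : 3 ^ x + 2 * 3 ^ y = 4 * n + 1)
    (h2 : 3 ^ x * 3 ^ y = 2 * n ^ 2 + 1) : n = 11 := by
  have p11 : ∀ k : ℕ, 3 ^ k ≠ 11 := by
    intro k hk
    rcases k with _ | _ | _ | k
    · simp at hk
    · simp at hk
    · simp at hk
    · rw [show k + 1 + 1 + 1 = k + 3 from rfl, pow_add] at hk; omega
  by_cases hxy : 3 ≤ x ∧ 3 ≤ y
  · exfalso
    obtain ⟨a, rfl⟩ := Nat.exists_eq_add_of_le hxy.1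
    obtain ⟨b, rfl⟩ := Nat.exists_eq_add_of_le hxy.2
    rw [pow_add, pow_add] at h1 h2
    generalize 3 ^ a = U at h1 h2
    generalize 3 ^ b = V at h1 h2
    zify at h1 h2
    have : 9 * (9 * ((U:ℤ) - 2 * V) ^ 2) = 6 * U + 12 * V - 1 := by nlinarith
    omega
  · have : x = 0 ∨ x = 1 ∨ x = 2 ∨ y = 0 ∨ y = 1 ∨ y = 2 := by omega
    rcases this with rfl | rfl | rfl | rfl | rfl | rfl
    · nlinarith
    · nlinarith
    · have : 3 ^ y + 4 = 2 * n := by omega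
      zify at *
      have : ((3:ℤ)^y) = 2 * n - 4 := by linarith
      rw [this] at h2
      have : 2 * ((n:ℤ)^2 - 9 * n + 18) = - 1 := by linarith
      omega
    · nlinarith
    · zify at h1 h2 hn ⊢
      have e : ((3:ℤ)^x) = 4 * n - 5 := by linarith
      rw [e] at h2
      have : ((n:ℤ) - 2) * (n - 4) = 0 := by linarith
      rcases mul_eq_zero.1 this with h | h
      · omega
      · exfalso; apply p11 x; zify; linarith
    · zify at h1 h2 hn ⊢
      have e : ((3:ℤ)^x) = 4 * n - 17 := by linarith
      rw [e] at h2
      have : ((n:ℤ) - 7) * (n - 11) = 0 := by linarith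
      rcases mul_eq_zero.1 this with h | h
      · exfalso; apply p11 x; zify; linarith
      · linarith

lemma dio_w (n m w : ℕ) (hn : 3 ≤ n) (hm : 3 ^ m = 2 * n ^ 2 + 1)
    (hw : (9:ℤ) * w ^ 2 - (12 * n + 3) * w + 4 * n ^ 2 + 2 = 0) : n = 11 := by
  have hZ : (w:ℤ) * (12 * n + 3 - 9 * w) = 2 * 3 ^ m := by
    have : (3:ℤ)^m = 2 * n^2+1 := by exact_mod_cast hm
    rw [this]; linarith
  have hpos : 0 ≤ (12 * (n:ℤ) + 3 - 9 * w) := by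
    by_contra h
    push Not at h
    have : (0:ℤ) < 2 * 3 ^ m := by positivity
    nlinarith
  obtain ⟨w', hw'⟩ := Int.eq_ofNat_of_zero_le hpos
  rw [hw'] at hZ
  have hN : w * w' = 2 * 3 ^ m := by exact_mod_cast hZ
  have hs : 9 * w + w' = 12 * n + 3 := by omega
  obtain ⟨c, d, hc, hd, rfl⟩ := (Nat.dvd_mul).1 (Dvd.intro _ hN)
  obtain ⟨a, ha, rfl⟩ := (Nat.dvd_prime_pow Nat.prime_three).1 hd
  obtain ⟨b, rfl⟩ := Nat.exists_eq_add_of_le ha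
  have h3 : 0 < 3 ^ a := by positivity
  rw [pow_add] at hN
  rcases (Nat.dvd_prime Nat.prime_two).1 hc with rfl | rfl
  · have e : w' = 2 * 3 ^ b := by
      apply Nat.eq_of_mul_eq_mul_left h3; linarith
    subst e
    rcases b with _ | b
    · omega
    · apply dio_aux n (a+1) b hn
      · rw [pow_succ] at *; omega
      · rw [← hm]; ring
  · have e : w' = 3 ^ b := by
      apply Nat.eq_of_mul_eq_mul_left h3; linarith
    subst e
    rcases b with _ | b
    · omega
    · apply dio_aux n b (a+1) hn
      · rw [pow_succ] at *; omega
      · rw [← hm]; ring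

/-- additive energy lower bound -/
lemma energy_lb {G K : Type*} [AddCommGroup G] [Fintype G] [DecidableEq G] [Fintype K]
    (e : K → G) (he : Function.Injective e) :
    (Fintype.card K : ℤ)^2 + 5 * ((Fintype.card K : ℤ)^2 - Fintype.card K) - 6 * ((Fintype.card G : ℤ) - 1)
      ≤ ∑ p, ∑ q, ∑ r, ∑ s, (if e r + e s = e p + e q then (1:ℤ) else 0) := by
  classical
  set h : G → ℤ := fun x => ∑ p, ∑ r, if e p - e r = x then (1:ℤ) else 0 with hh
  have hE : ∑ p, ∑ q, ∑ r, ∑ s, (if e r + e s = e p + e q then (1:ℤ) else 0) = ∑ x, h x ^ 2 := by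
    have h1 : ∑ x, h x ^ 2 = ∑ p, ∑ r, h (e p - e r) := by
      have : ∀ x, h x ^ 2 = ∑ p, ∑ r, if e p - e r = x then h x else 0 := by
        intro x
        rw [sq]
        conv_lhs => arg 1; rw [hh]
        simp only [Finset.sum_mul, ite_mul, one_mul, zero_mul]
      simp only [this]
      rw [Finset.sum_comm]
      refine Finset.sum_congr rfl fun p _ => ?_
      rw [Finset.sum_comm]
      refine Finset.sum_congr rfl fun r _ => ?_
      simp
    rw [h1]
    refine Finset.sum_congr rfl fun p _ => ?_
    rw [Finset.sum_comm]
    refine Finset.sum_congr rfl fun r _ => ?_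
    rw [Finset.sum_comm, hh]
    refine Finset.sum_congr rfl fun s _ => Finset.sum_congr rfl fun q _ => ?_
    refine if_congr ?_ rfl rfl
    rw [sub_eq_sub_iff_add_eq_add, add_comm]
  have hsum : ∑ x, h x = (Fintype.card K : ℤ)^2 := by
    rw [hh]
    rw [Finset.sum_comm]
    have : ∀ p : K, ∑ x : G, ∑ r : K, (if e p - e r = x then (1:ℤ) else 0) = Fintype.card K := by
      intro p
      rw [Finset.sum_comm]
      simp
    simp only [this]
    simp [sq]
  have h0 : h 0 = Fintype.card K := by
    rw [hh]
    simp [sub_eq_zero, he.eq_iff]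
  have hz : ∀ x, 5 * h x - 6 ≤ h x ^ 2 := by
    intro x
    have : 0 ≤ (h x - 2) * (h x - 3) := by
      rcases le_or_gt (h x) 2 with h' | h'
      · nlinarith
      · have : 3 ≤ h x := h'
        nlinarith
    nlinarith
  rw [hE, ← Finset.add_sum_erase _ _ (mem_univ (0:G)), h0]
  have h1 : ∑ x ∈ univ.erase (0:G), (5 * h x - 6) ≤ ∑ x ∈ univ.erase (0:G), h x ^ 2 :=
    Finset.sum_le_sum fun x _ => hz x
  have h2 := Finset.add_sum_erase univ h (mem_univ (0:G))
  rw [Finset.sum_sub_distrib, ← Finset.mul_sum, Finset.sum_const, 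
    Finset.card_erase_of_mem (mem_univ _), Finset.card_univ] at h1
  have hc : 1 ≤ Fintype.card G := Fintype.card_pos
  simp only [nsmul_eq_mul] at h1
  push_cast [Nat.cast_sub hc] at h1
  rw [hsum, h0] at h2
  linarith

/-- the set P -/
def ed {G : Type*} [AddCommGroup G] {n : ℕ} (g : Fin n → G) : Option (Fin n × Bool) → G
  | none => 0
  | some (i, true) => 2 • g i
  | some (i, false) => g i

/-- weak form of the tiling -/
def TileId {G : Type*} [AddCommGroup G] [Fintype G] {n : ℕ} (g : Fin n → G) : Prop :=
  ∀ F : G → ℤ, 2 * ∑ x, F x + ∑ i, (F (2 • g i) + 2 * F (3 • g i) + F (4 • g i)) =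
    2 * F 0 + 2 * ∑ i, (F (g i) + F (2 • g i)) +
      ∑ i, ∑ j, (F (g i + g j) + F (g i + 2 • g j) + F (2 • g i + g j) + F (2 • g i + 2 • g j))

section abs
variable {G : Type*} [AddCommGroup G] [Fintype G] [DecidableEq G] {n : ℕ} (g : Fin n → G)

lemma tile_card (hT : TileId g) : Fintype.card G = 2 * n ^ 2 + 1 := by
  have := hT (fun _ => 1)
  simp at this
  zify
  nlinarith

lemma sum_ed (F : G → ℤ) : ∑ p, F (ed g p) = F 0 + ∑ i, (F (g i) + F (2 • g i)) := by
  rw [Fintype.sum_option, Fintype.sum_prod_type]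
  simp only [Fintype.sum_bool, ed]
  congr 1
  exact Finset.sum_congr rfl fun i _ => add_comm _ _

lemma L_id (hT : TileId g) (F : G → ℤ) : ∑ p, ∑ q, F (ed g p + ed g q) =
    2 * ∑ x, F x + ∑ p, F (2 • ed g p) + 2 * ∑ i, F (3 • g i) - 2 * F 0 := by
  have h1 : ∀ x, ∑ q, F (x + ed g q) = F x + ∑ j, (F (x + g j) + F (x + 2 • g j)) := by
    intro x
    have := sum_ed g (fun y => F (x + y))
    simpa using this
  simp only [h1]
  rw [sum_ed g (fun x => F x + ∑ j, (F (x + g j) + F (x + 2 • g j))),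
    sum_ed g (fun x => F (2 • x))]
  have h4 : ∀ i, 2 • 2 • g i = 4 • g i := fun i => by rw [smul_smul]; norm_num
  simp only [zero_add, smul_zero, h4]
  have := hT F
  simp only [Finset.sum_add_distrib, ← Finset.mul_sum] at *
  linarith

lemma mu_bound (hT : TileId g) (hinj : Function.Injective (ed g)) :
    (n : ℤ) ^ 2 - 2 * n ≤ ∑ i, ∑ j, (if 3 • g j = 3 • g i then (1:ℤ) else 0) := by
  have hcard := tile_card g hT
  have hE := energy_lb (ed g) hinj
  have hK : Fintype.card (Option (Fin n × Bool)) = 2 * n + 1 := by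
    simp [mul_comm]
  have h2 : Function.Injective (fun x : G => 2 • x) := by
    have hc : (Nat.card G).Coprime 2 := by
      rw [Nat.card_eq_fintype_card, hcard]
      simp
    exact (nsmulCoprime hc).injective
  set q : G → ℤ := fun y => ∑ p, if 2 • ed g p = y then (1:ℤ) else 0 with hq
  set μ : G → ℤ := fun y => ∑ i, if 3 • g i = y then (1:ℤ) else 0 with hμ
  set f : G → ℤ := fun y => ∑ r, ∑ s, if ed g r + ed g s = y then (1:ℤ) else 0 with hf
  have hfy : ∀ y, f y = 2 + q y + 2 * μ y - 2 * (if (0:G) = y then 1 else 0) := by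
    intro y
    have := L_id g hT (fun x => if x = y then (1:ℤ) else 0)
    simpa [hf, hq, hμ] using this
  have hfE : ∑ p, ∑ q, ∑ r, ∑ s, (if ed g r + ed g s = ed g p + ed g q then (1:ℤ) else 0)
      = 2 * ∑ x, f x + ∑ p, f (2 • ed g p) + 2 * ∑ i, f (3 • g i) - 2 * f 0 :=
    L_id g hT f
  have hfsum : ∑ x, f x = (2 * n + 1) ^ 2 := by
    rw [hf, Finset.sum_comm]
    have : ∀ p, ∑ x : G, ∑ r, (if ed g p + ed g r = x then (1:ℤ) else 0) = 2 * n + 1 := by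
      intro p
      rw [Finset.sum_comm]
      simp [mul_comm]
    simp only [this]
    simp
    ring
  have hq1 : ∀ p, q (2 • ed g p) = 1 := by
    intro p
    have : ∀ r, (2 • ed g r = 2 • ed g p) ↔ r = p := by
      intro r
      rw [← hinj.eq_iff]
      exact h2.eq_iff
    simp only [hq, this]
    simp
  have hq0 : q 0 = 1 := by
    have := hq1 none
    simpa [ed] using this
  have hqle : ∀ y, q y ≤ 1 := by
    intro y
    by_cases h : ∃ p, 2 • ed g p = y
    · obtain ⟨p, rfl⟩ := h
      exact (hq1 p).le
    · push Not at h
      simp [hq, h]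
  have hQ : ∑ p, μ (2 • ed g p) = ∑ i, q (3 • g i) := by
    simp only [hq, hμ]
    rw [Finset.sum_comm]
    simp only [eq_comm]
  have hQle : ∑ i, q (3 • g i) ≤ n := by
    calc _ ≤ ∑ i : Fin n, (1:ℤ) := Finset.sum_le_sum fun i _ => hqle _
      _ = n := by simp
  have hd : ∑ p, (if (0:G) = 2 • ed g p then (1:ℤ) else 0) = 1 := by
    have := hq0
    simp only [hq] at this
    simpa only [eq_comm] using this
  have hm0 : ∑ i, (if (0:G) = 3 • g i then (1:ℤ) else 0) = μ 0 := by
    simp only [hμ, eq_comm]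
  have hm0' : 0 ≤ μ 0 := Finset.sum_nonneg fun i _ => by split_ifs <;> simp
  have e1 : ∑ p, f (2 • ed g p) = 3 * (2 * n + 1) + 2 * ∑ i, q (3 • g i) - 2 := by
    simp only [hfy, Finset.sum_add_distrib, Finset.sum_sub_distrib, ← Finset.mul_sum, hd, hQ, hq1]
    simp
    ring
  have e2 : ∑ i, f (3 • g i) = 2 * n + ∑ i, q (3 • g i) + 2 * ∑ i, μ (3 • g i) - 2 * μ 0 := by
    simp only [hfy, Finset.sum_add_distrib, Finset.sum_sub_distrib, ← Finset.mul_sum, hm0]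
    simp
    ring
  have e3 : f 0 = 1 + 2 * μ 0 := by
    rw [hfy, hq0]; simp; ring
  rw [hfE, hfsum, e1, e2, e3, hK, hcard] at hE
  push_cast at hE
  change _ ≤ ∑ i, μ (3 • g i)
  linarith

lemma tors_bound (hT : TileId g) (hinj : Function.Injective (ed g))
    (hU : ∀ i j i' j', i ≠ j → i' ≠ j' → g i + g j' = g i' + g j → i = i' ∧ j = j') :
    (n : ℤ) ^ 2 - 3 * n + 1 ≤ (univ.filter (fun x : G => 3 • x = 0)).card := by
  have hm := mu_bound g hT hinj
  set Z := (univ : Finset (Fin n × Fin n)).filter (fun p => 3 • g p.2 = 3 • g p.1) with hZ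
  have hZc : ∑ i, ∑ j, (if 3 • g j = 3 • g i then (1:ℤ) else 0) = Z.card := by
    rw [hZ, Finset.card_filter, Fintype.sum_prod_type]
    push_cast
    rfl
  rw [hZc] at hm
  set Z' := Z.filter (fun p => p.1 ≠ p.2) with hZ'
  have h1 : Z.card ≤ Z'.card + n := by
    have := Finset.card_filter_add_card_filter_not (s := Z) (fun p => p.1 ≠ p.2)
    rw [← hZ'] at this
    have h2 : (Z.filter (fun p => ¬ p.1 ≠ p.2)).card ≤ n := by
      calc _ ≤ (univ : Finset (Fin n)).card := by
            apply Finset.card_le_card_of_injOn Prod.fst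
            · simp
            · intro a ha b hb hab
              simp at ha hb
              ext
              · rw [hab]
              · rw [← ha.2, ← hb.2, hab]
        _ = n := by simp
    omega
  have h2 : Z'.card + 1 ≤ (univ.filter (fun x : G => 3 • x = 0)).card := by
    have h3 : Z'.card ≤ ((univ.filter (fun x : G => 3 • x = 0)).erase 0).card := by
      apply Finset.card_le_card_of_injOn (fun p => g p.1 - g p.2)
      · intro p hp
        simp [hZ', hZ] at hp
        simp only [Finset.coe_erase, Set.mem_sdiff, Finset.mem_coe, Finset.mem_filter, Finset.mem_univ, true_and, Set.mem_singleton_iff]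
        refine ⟨?_, fun h0 => hp.2 ?_⟩
        swap
        · have := @hinj (some (p.1, false)) (some (p.2, false)) (sub_eq_zero.1 h0)
          simpa using this
        rw [smul_sub, hp.1, sub_self]
      · intro p hp p' hp' h
        simp [hZ', hZ] at hp hp'
        obtain ⟨a, b⟩ := hU _ _ _ _ hp.2 hp'.2 (sub_eq_sub_iff_add_eq_add.1 h)
        exact Prod.ext a b
    rw [Finset.card_erase_of_mem (by simp)] at h3
    have : 0 < (univ.filter (fun x : G => 3 • x = 0)).card := Finset.card_pos.2 ⟨0, by simp⟩
    omega
  have h1' : (Z.card : ℤ) ≤ Z'.card + n := by exact_mod_cast h1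
  have h2' : (Z'.card : ℤ) + 1 ≤ (univ.filter (fun x : G => 3 • x = 0)).card := by exact_mod_cast h2
  linarith

lemma tors_all (hn : 4 ≤ n) (hT : TileId g) (hinj : Function.Injective (ed g))
    (hU : ∀ i j i' j', i ≠ j → i' ≠ j' → g i + g j' = g i' + g j → i = i' ∧ j = j') :
    ∀ x : G, 3 • x = 0 := by
  have hb := tors_bound g hT hinj hU
  have hcard := tile_card g hT
  let H : AddSubgroup G := (nsmulAddMonoidHom (α := G) 3).ker
  have hH : ∀ x, x ∈ H ↔ 3 • x = 0 := fun x => Iff.rfl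
  have hHc : Nat.card H = (univ.filter (fun x : G => 3 • x = 0)).card := by
    exact Nat.subtype_card _ (fun x => by simp [hH])
  let _ : Module (ZMod 3) H := AddCommGroup.zmodModule (n := 3) (by
    rintro ⟨x, hx⟩
    ext
    exact hx)
  have hpow : Nat.card H = 3 ^ Module.finrank (ZMod 3) H := by
    rw [Module.natCard_eq_pow_finrank (K := ZMod 3)]
    simp
  have hdvd : Nat.card H ∣ 2 * n ^ 2 + 1 := by
    rw [← hcard, ← Nat.card_eq_fintype_card]
    exact AddSubgroup.card_addSubgroup_dvd_card H
  rw [← hHc] at hb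
  have hfull : Nat.card H = 2 * n ^ 2 + 1 := by
    rcases lt_or_ge n 9 with h9 | h9
    · exfalso
      rw [hpow] at hb hdvd
      set k := Module.finrank (ZMod 3) H
      have hk : k < 5 := by
        by_contra hk
        push Not at hk
        have h1 := Nat.le_of_dvd (by positivity) hdvd
        have h2 : 3 ^ 5 ≤ 3 ^ k := Nat.pow_le_pow_right (by norm_num) hk
        nlinarith
      clear_value k
      clear hpow
      interval_cases n <;> interval_cases k <;> first | (norm_num at hb; done) | (norm_num at hdvd; done)
    · obtain ⟨c, hc⟩ := hdvd
      have : c < 3 := by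
        by_contra h
        push Not at h
        have h1 : Nat.card H * 3 ≤ 2 * n ^ 2 + 1 := by
          rw [hc]; exact Nat.mul_le_mul_left _ h
        zify at h1 h9
        nlinarith
      interval_cases c <;> omega
  intro x
  have : H = ⊤ := by
    rw [← AddSubgroup.card_eq_iff_eq_top, hfull, Nat.card_eq_fintype_card, hcard]
  rw [← hH, this]
  trivial

lemma ker_count (hT : TileId g) (φ : G →+ ZMod 3) (hφ : Function.Surjective φ) :
    ∃ w : ℕ, (9:ℤ) * w ^ 2 - (12 * n + 3) * w + 4 * n ^ 2 + 2 = 0 := by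
  have hcard := tile_card g hT
  have h3 : 3 * ∑ x, (if φ x = 0 then (1:ℤ) else 0) = 2 * n ^ 2 + 1 := by
    have hc : ∀ c : ZMod 3, ∑ x, (if φ x = c then (1:ℤ) else 0)
        = ∑ x, (if φ x = 0 then (1:ℤ) else 0) := by
      intro c
      obtain ⟨y, rfl⟩ := hφ c
      rw [← Equiv.sum_comp (Equiv.addRight y)]
      simp
    have : ∑ c : ZMod 3, ∑ x, (if φ x = c then (1:ℤ) else 0) = 2 * n ^ 2 + 1 := by
      rw [Finset.sum_comm]
      simp [hcard]
    simp only [hc] at this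
    simpa using this
  set z : Fin n → ℤ := fun i => if φ (g i) = 0 then 1 else 0 with hz
  have key := hT (fun x => if φ x = 0 then 1 else 0)
  have d1 : ∀ a b : ZMod 3, ((if a + b = 0 then (1:ℤ) else 0) + (if a + 2 • b = 0 then 1 else 0)
      + (if 2 • a + b = 0 then 1 else 0) + (if 2 • a + 2 • b = 0 then 1 else 0)) =
      4 * ((if a = 0 then 1 else 0) * (if b = 0 then 1 else 0)) +
      2 * ((1 - if a = 0 then 1 else 0) * (1 - if b = 0 then 1 else 0)) := by decide
  have d2 : ∀ a : ZMod 3, (if 2 • a = 0 then (1:ℤ) else 0) = if a = 0 then 1 else 0 := by decide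
  have d3 : ∀ a : ZMod 3, (if 3 • a = 0 then (1:ℤ) else 0) = 1 := by decide
  have d4 : ∀ a : ZMod 3, (if 4 • a = 0 then (1:ℤ) else 0) = if a = 0 then 1 else 0 := by decide
  simp only [map_add, map_nsmul, d1, d2, d3, d4, map_zero] at key
  set c : ℕ := (univ.filter (fun i => φ (g i) = 0)).card with hc
  have hzc : ∑ i, (if φ (g i) = 0 then (1:ℤ) else 0) = c := by
    rw [hc, Finset.card_filter]; push_cast; rfl
  have hcn : c ≤ n := by
    simpa using Finset.card_le_univ (univ.filter (fun i => φ (g i) = 0))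
  refine ⟨n - c, ?_⟩
  simp only [Finset.sum_add_distrib, ← Finset.mul_sum, ← Finset.sum_mul, Finset.sum_sub_distrib, hzc] at key
  generalize ∑ x, (if φ x = 0 then (1:ℤ) else 0) = S at h3 key
  simp at key
  push_cast [Nat.cast_sub hcn]
  nlinarith

lemma abs_main (hn : 3 ≤ n) (hT : TileId g) (hinj : Function.Injective (ed g))
    (hU : ∀ i j i' j', i ≠ j → i' ≠ j' → g i + g j' = g i' + g j → i = i' ∧ j = j') :
    (n = 3 ∨ n = 11) ∧ (n = 3 → Nonempty (G ≃+ ZMod 19)) ∧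
      (n = 11 → Nonempty (G ≃+ (Fin 5 → ZMod 3))) := by
  have hcard := tile_card g hT
  rcases Nat.eq_or_lt_of_le hn with rfl | h4
  · refine ⟨Or.inl rfl, fun _ => ?_, fun h => by omega⟩
    have : Fact (Nat.Prime 19) := ⟨by norm_num⟩
    have hc : Nat.card G = 19 := by rw [Nat.card_eq_fintype_card, hcard]; norm_num
    have : IsAddCyclic G := isAddCyclic_of_prime_card hc
    exact ⟨(zmodAddCyclicAddEquiv (G := G) inferInstance).symm.trans
      (hc ▸ AddEquiv.refl _)⟩
  · have ht := tors_all g h4 hT hinj hU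
    let _ : Module (ZMod 3) G := AddCommGroup.zmodModule (n := 3) ht
    have hpow : Nat.card G = 3 ^ Module.finrank (ZMod 3) G := by
      rw [Module.natCard_eq_pow_finrank (K := ZMod 3)]
      simp
    rw [Nat.card_eq_fintype_card, hcard] at hpow
    set m := Module.finrank (ZMod 3) G with hm
    let E : G ≃ₗ[ZMod 3] (Fin m → ZMod 3) := (Module.finBasis (ZMod 3) G).equivFun
    have hm0 : 0 < m := by
      rcases Nat.eq_zero_or_pos m with h | h
      · rw [h] at hpow
        simp at hpow
        omega
      · exact h
    let φ : G →+ ZMod 3 := (Pi.evalAddMonoidHom (fun _ : Fin m => ZMod 3) ⟨0, hm0⟩).comp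
      E.toAddEquiv.toAddMonoidHom
    have hφ : Function.Surjective φ := by
      intro c
      exact ⟨E.symm (fun _ => c), by simp [φ]⟩
    obtain ⟨w, hw⟩ := ker_count g hT φ hφ
    have h11 : n = 11 := dio_w n m w hn hpow.symm hw
    refine ⟨Or.inr h11, fun h => by omega, fun _ => ?_⟩
    have hm5 : m = 5 := by
      rw [h11] at hpow
      have : 3 ^ 5 = 3 ^ m := by rw [← hpow]; norm_num
      exact (Nat.pow_right_injective (le_refl 2 |>.trans (by norm_num)) this).symm
    rw [hm5] at E
    exact ⟨E.toAddEquiv⟩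
end abs

/-- coefficient -/
def cb (b : Bool) : ℤ := if b then 2 else 1

/-- enumeration of the ball -/
def bvec {n : ℕ} : Option (Fin n × Bool) ⊕ ({p : Fin n × Fin n // p.1 < p.2} × Bool × Bool) →
    (Fin n → ℤ)
  | Sum.inl none => 0
  | Sum.inl (some (i, a)) => Pi.single i (cb a)
  | Sum.inr (p, a, b) => Pi.single p.1.1 (cb a) + Pi.single p.1.2 (cb b)

lemma cb_cases (b : Bool) : cb b = 1 ∧ b = false ∨ cb b = 2 ∧ b = true := by
  cases b <;> simp [cb]

lemma pair_mem {n : ℕ} (i j : Fin n) (a b : ℤ) (ha : 0 ≤ a) (hb : 0 ≤ b) (ha2 : a ≤ 2) (hb2 : b ≤ 2)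
    (hab : i = j → a + b ≤ 2) :
    Pi.single i a + Pi.single j b ∈ errBall n 2 2 0 := by
  refine ⟨fun k => ?_, ?_⟩
  · simp only [Pi.add_apply, Pi.single_apply]
    split_ifs with h1 h2 <;> subst_vars <;> simp_all <;> omega
  · unfold wt
    refine (Finset.card_le_card (t := {i, j}) ?_).trans Finset.card_le_two
    intro k hk
    simp only [Finset.mem_filter, Finset.mem_univ, true_and, Pi.add_apply, Pi.single_apply] at hk
    simp only [Finset.mem_insert, Finset.mem_singleton]
    by_contra h
    push Not at h
    simp [h.1, h.2] at hk

lemma bvec_mem {n : ℕ} (r) : bvec (n := n) r ∈ errBall n 2 2 0 := by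
  rcases r with (_ | ⟨i, a⟩) | ⟨⟨⟨i, j⟩, hij⟩, a, b⟩
  · refine ⟨fun i => by simp [bvec], by simp [bvec, wt]⟩
  · have := pair_mem i i (cb a) 0
    simp only [Pi.single_zero, add_zero] at this
    rcases cb_cases a with ⟨h, -⟩ | ⟨h, -⟩ <;> (apply this <;> omega)
  · simp only at hij
    rcases cb_cases a with ⟨h, -⟩ | ⟨h, -⟩ <;> rcases cb_cases b with ⟨h', -⟩ | ⟨h', -⟩ <;>
    (apply pair_mem <;> first | omega | (intro h; exact absurd h (ne_of_lt hij)))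

lemma bvec_inj {n : ℕ} : Function.Injective (bvec (n := n)) := by
  rintro ((_ | ⟨i, a⟩) | ⟨⟨⟨i, j⟩, hij⟩, a, b⟩) ((_ | ⟨i', a'⟩) | ⟨⟨⟨i', j'⟩, hij'⟩, a', b'⟩) h
  · rfl
  · have h1 := congrFun h i'
    have := cb_cases a'
    simp [bvec] at h1
    omega
  · have h1 := congrFun h i'
    have := cb_cases a'
    simp only at hij'
    simp [bvec, Pi.single_apply, hij'.ne] at h1
    omega
  · have h1 := congrFun h i
    have := cb_cases a
    simp [bvec] at h1
    omega
  · have h1 := congrFun h i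
    have := cb_cases a
    have := cb_cases a'
    simp [bvec, Pi.single_apply] at h1
    grind
  · have h1 := congrFun h i'
    have h2 := congrFun h j'
    have := cb_cases a
    have := cb_cases a'
    have := cb_cases b'
    simp [bvec, Pi.single_apply] at h1 h2
    grind
  · have h1 := congrFun h i
    have := cb_cases a
    simp only at hij
    simp [bvec, Pi.single_apply, hij.ne] at h1
    omega
  · have h1 := congrFun h i
    have h2 := congrFun h j
    have := cb_cases a
    have := cb_cases a'
    have := cb_cases b
    simp [bvec, Pi.single_apply] at h1 h2
    grind
  · have h1 := congrFun h i
    have h2 := congrFun h j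
    have h3 := congrFun h i'
    have h4 := congrFun h j'
    have := cb_cases a
    have := cb_cases a'
    have := cb_cases b
    have := cb_cases b'
    simp only at hij hij'
    simp [bvec, Pi.single_apply] at h1 h2 h3 h4
    have e1 : i = i' := by grind
    have e2 : j = j' := by grind
    subst e1 e2
    simp [hij.ne, hij.ne'] at h1 h2
    grind

lemma bvec_surj {n : ℕ} (x : Fin n → ℤ) (hx : x ∈ errBall n 2 2 0) : ∃ r, bvec r = x := by
  obtain ⟨h1, h2⟩ := hx
  have hcb : ∀ i, x i ≠ 0 → ∃ a, cb a = x i := by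
    intro i hi
    have := h1 i
    have : x i = 1 ∨ x i = 2 := by omega
    rcases this with h | h
    · exact ⟨false, by simp [cb, h]⟩
    · exact ⟨true, by simp [cb, h]⟩
  have hmem : ∀ k, k ∈ (Finset.univ.filter (fun i => x i ≠ 0)) ↔ x k ≠ 0 := by simp
  unfold wt at h2
  generalize (Finset.univ.filter (fun i => x i ≠ 0)) = s at h2 hmem
  have : s.card = 0 ∨ s.card = 1 ∨ s.card = 2 := by omega
  rcases this with h | h | h
  · rw [Finset.card_eq_zero] at h
    subst h
    refine ⟨Sum.inl none, funext fun k => ?_⟩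
    have := hmem k
    simp at this
    simp [bvec, this]
  · obtain ⟨i, rfl⟩ := Finset.card_eq_one.1 h
    obtain ⟨a, ha⟩ := hcb i ((hmem i).1 (by simp))
    refine ⟨Sum.inl (some (i, a)), funext fun k => ?_⟩
    have := hmem k
    simp at this
    simp only [bvec, Pi.single_apply]
    grind
  · obtain ⟨i, j, hij, rfl⟩ := Finset.card_eq_two.1 h
    obtain ⟨a, ha⟩ := hcb i ((hmem i).1 (by simp))
    obtain ⟨b, hb⟩ := hcb j ((hmem j).1 (by simp))
    rcases lt_or_gt_of_ne hij with hl | hl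
    · refine ⟨Sum.inr (⟨(i, j), hl⟩, a, b), funext fun k => ?_⟩
      have := hmem k
      simp at this
      simp only [bvec, Pi.add_apply, Pi.single_apply]
      grind
    · refine ⟨Sum.inr (⟨(j, i), hl⟩, b, a), funext fun k => ?_⟩
      have := hmem k
      simp at this
      simp only [bvec, Pi.add_apply, Pi.single_apply]
      grind

lemma sum_pairs {n : ℕ} (H : Fin n → Fin n → ℤ) (hs : ∀ i j, H i j = H j i) :
    2 * ∑ p : {p : Fin n × Fin n // p.1 < p.2}, H p.1.1 p.1.2 + ∑ i, H i i = ∑ i, ∑ j, H i j := by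
  have h1 : ∑ p : {p : Fin n × Fin n // p.1 < p.2}, H p.1.1 p.1.2
      = ∑ i, ∑ j, if i < j then H i j else 0 := by
    rw [← Fintype.sum_prod_type' (f := fun i j => if i < j then H i j else 0), ← Finset.sum_filter]
    symm
    exact Finset.sum_subtype _ (by simp) (fun p : Fin n × Fin n => H p.1 p.2)
  have h2 : ∑ i, ∑ j, (if i < j then H i j else 0) = ∑ i, ∑ j, if j < i then H i j else 0 := by
    rw [Finset.sum_comm]
    simp only [hs]
  have h3 : ∑ i, H i i = ∑ i, ∑ j, if i = j then H i j else 0 := by simp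
  rw [two_mul, h1]
  conv_lhs => arg 1; arg 2; rw [h2]
  rw [h3]
  simp only [← Finset.sum_add_distrib]
  refine Finset.sum_congr rfl fun i _ => Finset.sum_congr rfl fun j _ => ?_
  rcases lt_trichotomy i j with h | h | h
  · simp [h, h.ne, h.not_gt]
  · simp [h]
  · simp [h, h.ne', h.not_gt]

theorem stmt_19 (n : ℕ) (hn : 3 ≤ n)
    (Λ : AddSubgroup (Fin n → ℤ))
    (htile : Tiles (errBall n 2 2 0) (Λ : Set (Fin n → ℤ))) :
    (n = 3 ∨ n = 11) ∧
    (n = 3 → Nonempty (((Fin n → ℤ) ⧸ Λ) ≃+ ZMod 19)) ∧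
    (n = 11 → Nonempty (((Fin n → ℤ) ⧸ Λ) ≃+ (Fin 5 → ZMod 3))) := by
  classical
  let π : (Fin n → ℤ) →+ ((Fin n → ℤ) ⧸ Λ) := QuotientAddGroup.mk' Λ
  have hinjB : ∀ x ∈ errBall n 2 2 0, ∀ y ∈ errBall n 2 2 0, π x = π y → x = y := by
    intro x hx y hy h
    have hm : x - y ∈ Λ := by
      rw [← QuotientAddGroup.eq_zero_iff]
      have : π (x - y) = 0 := by rw [map_sub, h, sub_self]
      exact this
    have := (htile x).unique (y₁ := (0, x)) (y₂ := (x - y, y))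
      ⟨Λ.zero_mem, hx, by simp⟩ ⟨hm, hy, by simp⟩
    exact (Prod.ext_iff.1 this).2
  let Φ := fun r => π (bvec (n := n) r)
  have hΦ : Function.Bijective Φ := by
    constructor
    · intro r s h
      exact bvec_inj (hinjB _ (bvec_mem r) _ (bvec_mem s) h)
    · intro y
      obtain ⟨z, rfl⟩ := QuotientAddGroup.mk'_surjective Λ y
      obtain ⟨⟨v, b⟩, ⟨hv, hb, hz⟩, -⟩ := htile z
      obtain ⟨r, hr⟩ := bvec_surj b hb
      refine ⟨r, ?_⟩
      have hv0 : π v = 0 := (QuotientAddGroup.eq_zero_iff v).2 hv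
      change π (bvec r) = π z
      rw [hr, hz]
      simp only [map_add, hv0, zero_add]
  let _ : Fintype ((Fin n → ℤ) ⧸ Λ) := Fintype.ofBijective Φ hΦ
  let g : Fin n → ((Fin n → ℤ) ⧸ Λ) := fun i => π (Pi.single i 1)
  have hg2 : ∀ i, π (Pi.single i 2) = 2 • g i := by
    intro i
    change _ = 2 • π _
    rw [← map_nsmul, ← Pi.single_smul]
    simp
  have hed : ∀ p, Φ (Sum.inl p) = ed g p := by
    rintro (_ | ⟨i, _ | _⟩)
    · simp [Φ, bvec, ed]
    · simp [Φ, bvec, ed, cb, g]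
    · simp [Φ, bvec, ed, cb, hg2]
  refine abs_main g hn ?_ ?_ ?_
  · intro F
    have h1 : ∑ x, F x = ∑ r, F (Φ r) := (hΦ.sum_comp F).symm
    rw [h1, Fintype.sum_sum_type]
    simp only [hed]
    rw [sum_ed]
    have h2 : ∑ p, F (Φ (Sum.inr p)) = ∑ p : {p : Fin n × Fin n // p.1 < p.2}, 
        (fun i j => (F (g i + g j) + F (g i + 2 • g j) + F (2 • g i + g j) + F (2 • g i + 2 • g j)))
          p.1.1 p.1.2 := by
      rw [Fintype.sum_prod_type]
      refine Finset.sum_congr rfl fun p _ => ?_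
      rw [Fintype.sum_prod_type]
      simp only [Fintype.sum_bool, Φ, bvec, cb, map_add, hg2]
      simp [hg2, g]
      ring
    rw [h2]
    have h3 := sum_pairs (fun i j => (F (g i + g j) + F (g i + 2 • g j) + F (2 • g i + g j) + F (2 • g i + 2 • g j)))
      (fun i j => by
        simp only [add_comm (g j), add_comm (2 • g j)]
        ring)
    rw [← h3]
    have h4 : ∀ i, F (g i + g i) + F (g i + 2 • g i) + F (2 • g i + g i) + F (2 • g i + 2 • g i)
        = F (2 • g i) + 2 * F (3 • g i) + F (4 • g i) := by
      intro i
      rw [show g i + g i = 2 • g i by abel, show g i + 2 • g i = 3 • g i by abel,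
        show 2 • g i + g i = 3 • g i by abel, show 2 • g i + 2 • g i = 4 • g i by abel]
      ring
    simp only [h4]
    ring
  · intro p q h
    rw [← hed, ← hed] at h
    exact Sum.inl_injective (hΦ.1 h)
  · intro i j k l hij hkl h
    have h' : π (Pi.single i 1 + Pi.single l 1) = π (Pi.single k 1 + Pi.single j 1) := by
      rw [map_add, map_add]; exact h
    have := hinjB _ (pair_mem i l 1 1 (by norm_num) (by norm_num) (by norm_num) (by norm_num) (by norm_num))
      _ (pair_mem k j 1 1 (by norm_num) (by norm_num) (by norm_num) (by norm_num) (by norm_num)) h'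
    have h1 := congrFun this i
    have h2 := congrFun this j
    have h3 := congrFun this k
    have h4 := congrFun this l
    simp only [Pi.add_apply, Pi.single_apply] at h1 h2 h3 h4
    grind
end
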